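/- Let p, q ∈ ℝ³, p⁰ = √(1+|p|²), q⁰ = √(1+|q|²) (Euclidean norms), n = p+q, n⁰ = p⁰+q⁰, s = (n⁰)² − |n|², and h = √(s−4) (well-defined since s ≥ 4). (i) For every unit vector ξ ∈ S², one has (n⁰)² > (n·ξ)², and the Glassey–Strauss post-collision momentum p' = n/2 + (h/2) n⁰ ξ/√((n⁰)² − (n·ξ)²) with energy p'⁰ = n⁰/2 + (h/2)(n·ξ)/√((n⁰)² − (n·ξ)²) satisfies the mass shell relation (p'⁰)² = 1 + |p'|² and p'⁰ > 0; moreover q' = n − p' with q'⁰ = n⁰ − p'⁰ satisfies (q'⁰)² = 1 + |q'|² and q'⁰ > 0. (ii) If in addition n ≠ 0, then for every unit vector ω ∈ S² the Strain post-collision momentum p' = n/2 + (h/2)(ω + (n⁰/√s − 1)(n·ω)n/|n|²) with energy p'⁰ = n⁰/2 + (h/2)(n·ω)/√s satisfies (p'⁰)² = 1 + |p'|² and p'⁰ > 0, and likewise for q' = n − p', q'⁰ = n⁰ − p'⁰. -/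

import Mathlib

open Matrix

/-- Minkowski energy `p⁰ = √(1+|p|²)` of a momentum `p ∈ ℝ³` on the unit mass shell. -/
noncomputable def en (p : Fin 3 → ℝ) : ℝ := Real.sqrt (1 + p ⬝ᵥ p)

/-- Total energy `s = (p⁰+q⁰)² − |p+q|²` of a colliding pair. -/
noncomputable def sM (p q : Fin 3 → ℝ) : ℝ := (en p + en q) ^ 2 - (p + q) ⬝ᵥ (p + q)

/-- Relative momentum `h = √(s−4)`. -/
noncomputable def hM (p q : Fin 3 → ℝ) : ℝ := Real.sqrt (sM p q - 4)

/-- Glassey–Strauss post-collision momentum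
`p' = n/2 + (h/2) n⁰ ξ / √((n⁰)² − (n·ξ)²)`, with `n = p+q`, `n⁰ = p⁰+q⁰`. -/
noncomputable def pGS (p q ξ : Fin 3 → ℝ) : Fin 3 → ℝ := fun i =>
  (p i + q i) / 2 + hM p q / 2 * (en p + en q) * ξ i /
    Real.sqrt ((en p + en q) ^ 2 - ((p + q) ⬝ᵥ ξ) ^ 2)

/-- Energy of the Glassey–Strauss post-collision momentum,
`p'⁰ = n⁰/2 + (h/2)(n·ξ)/√((n⁰)² − (n·ξ)²)`. -/
noncomputable def pGS0 (p q ξ : Fin 3 → ℝ) : ℝ :=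
  (en p + en q) / 2 + hM p q / 2 * ((p + q) ⬝ᵥ ξ) /
    Real.sqrt ((en p + en q) ^ 2 - ((p + q) ⬝ᵥ ξ) ^ 2)

/-- Strain post-collision momentum
`p' = n/2 + (h/2)(ω + (n⁰/√s − 1)(n·ω)n/|n|²)`. -/
noncomputable def pSt (p q ω : Fin 3 → ℝ) : Fin 3 → ℝ := fun i =>
  (p i + q i) / 2 + hM p q / 2 *
    (ω i + ((en p + en q) / Real.sqrt (sM p q) - 1) *
      ((p + q) ⬝ᵥ ω) * (p i + q i) / ((p + q) ⬝ᵥ (p + q)))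

/-- Energy of the Strain post-collision momentum, `p'⁰ = n⁰/2 + (h/2)(n·ω)/√s`. -/
noncomputable def pSt0 (p q ω : Fin 3 → ℝ) : ℝ :=
  (en p + en q) / 2 + hM p q / 2 * ((p + q) ⬝ᵥ ω) / Real.sqrt (sM p q)

theorem dotProduct_sq_le (u v : Fin 3 → ℝ) : (u ⬝ᵥ v) ^ 2 ≤ (u ⬝ᵥ u) * (v ⬝ᵥ v) := by
  simpa [dotProduct, sq] using Finset.sum_mul_sq_le_sq_mul_sq Finset.univ u v

theorem dotProduct_self_nonneg_real (u : Fin 3 → ℝ) : 0 ≤ u ⬝ᵥ u :=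
  Finset.sum_nonneg fun i _ => mul_self_nonneg (u i)

theorem en_sq (p : Fin 3 → ℝ) : en p ^ 2 = 1 + p ⬝ᵥ p :=
  Real.sq_sqrt (by linarith [dotProduct_self_nonneg_real p])

theorem en_pos (p : Fin 3 → ℝ) : 0 < en p :=
  Real.sqrt_pos.2 (by linarith [dotProduct_self_nonneg_real p])

theorem one_add_dotProduct_le_en_mul_en (p q : Fin 3 → ℝ) : 1 + p ⬝ᵥ q ≤ en p * en q := by
  refine le_of_abs_le (abs_le_of_sq_le_sq ?_ (mul_pos (en_pos p) (en_pos q)).le)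
  have hsub := dotProduct_self_nonneg_real (p - q)
  simp only [sub_dotProduct, dotProduct_sub, dotProduct_comm q p] at hsub
  rw [mul_pow, en_sq, en_sq]
  linarith [dotProduct_sq_le p q]

theorem four_le_sM (p q : Fin 3 → ℝ) : 4 ≤ sM p q := by
  have h := one_add_dotProduct_le_en_mul_en p q
  simp only [sM, add_dotProduct, dotProduct_add, dotProduct_comm q p]
  linarith [en_sq p, en_sq q]

theorem hM_sq (p q : Fin 3 → ℝ) : hM p q ^ 2 = sM p q - 4 :=
  Real.sq_sqrt (by linarith [four_le_sM p q])

/-- If `(e, v)` is Minkowski-orthogonal to the total momentum `(N, n)` and has Minkowski square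
`-(N² - |n|² - 4) / 4`, then both `(N, n) / 2 ± (e, v)` lie on the future unit mass shell. -/
theorem mass_shell_of_orthogonal {N e : ℝ} {n v : Fin 3 → ℝ} (hN : 0 < N)
    (hs : 4 ≤ N ^ 2 - n ⬝ᵥ n) (hv : v ⬝ᵥ v - e ^ 2 = (N ^ 2 - n ⬝ᵥ n - 4) / 4)
    (hortho : N * e = n ⬝ᵥ v) {P : Fin 3 → ℝ} {P0 : ℝ}
    (hP : P = (1 / 2 : ℝ) • n + v) (hP0 : P0 = N / 2 + e) :
    P0 ^ 2 = 1 + P ⬝ᵥ P ∧ 0 < P0 ∧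
      (N - P0) ^ 2 = 1 + (n - P) ⬝ᵥ (n - P) ∧ 0 < N - P0 := by
  have he : |e| < N / 2 := by
    have hCS := dotProduct_sq_le n v
    rw [← hortho] at hCS
    have hn := dotProduct_self_nonneg_real n
    have hvv : v ⬝ᵥ v = e ^ 2 + (N ^ 2 - n ⬝ᵥ n - 4) / 4 := by linarith
    rw [hvv] at hCS
    refine abs_lt_of_sq_lt_sq ?_ (by positivity)
    have hmul : (N ^ 2 - n ⬝ᵥ n) * e ^ 2 < (N ^ 2 - n ⬝ᵥ n) * (N / 2) ^ 2 := by
      nlinarith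
    exact lt_of_mul_lt_mul_left hmul (by linarith)
  obtain ⟨h1, h2⟩ := abs_lt.1 he
  subst hP hP0
  refine ⟨?_, by linarith, ?_, by linarith⟩ <;>
  · simp only [sub_dotProduct, dotProduct_sub, add_dotProduct, dotProduct_add, smul_dotProduct,
      dotProduct_smul, smul_eq_mul, dotProduct_comm v n, ← hortho]
    linarith

/-- Both the Glassey–Strauss and the Strain parametrizations of the post-collision
momenta lie on the unit mass shell and have positive energies; moreover `s ≥ 4` and
`(n⁰)² > (n·ξ)²` for every unit vector `ξ`. -/
theorem stmt_18 (p q : Fin 3 → ℝ) :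
    4 ≤ sM p q ∧
    (∀ ξ : Fin 3 → ℝ, ξ ⬝ᵥ ξ = 1 →
      ((p + q) ⬝ᵥ ξ) ^ 2 < (en p + en q) ^ 2 ∧
      (pGS0 p q ξ) ^ 2 = 1 + pGS p q ξ ⬝ᵥ pGS p q ξ ∧
      0 < pGS0 p q ξ ∧
      (en p + en q - pGS0 p q ξ) ^ 2
        = 1 + (p + q - pGS p q ξ) ⬝ᵥ (p + q - pGS p q ξ) ∧
      0 < en p + en q - pGS0 p q ξ) ∧
    (p + q ≠ 0 → ∀ ω : Fin 3 → ℝ, ω ⬝ᵥ ω = 1 →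
      (pSt0 p q ω) ^ 2 = 1 + pSt p q ω ⬝ᵥ pSt p q ω ∧
      0 < pSt0 p q ω ∧
      (en p + en q - pSt0 p q ω) ^ 2
        = 1 + (p + q - pSt p q ω) ⬝ᵥ (p + q - pSt p q ω) ∧
      0 < en p + en q - pSt0 p q ω) := by
  have hs := four_le_sM p q
  have hh := hM_sq p q
  have hN : 0 < en p + en q := add_pos (en_pos p) (en_pos q)
  have hsdef : sM p q = (en p + en q) ^ 2 - (p + q) ⬝ᵥ (p + q) := rfl
  refine ⟨hs, fun ξ hξ => ?_, fun hn ω hω => ?_⟩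
  · have hlt : ((p + q) ⬝ᵥ ξ) ^ 2 < (en p + en q) ^ 2 := by
      have hCS := dotProduct_sq_le (p + q) ξ
      rw [hξ] at hCS
      linarith
    have hRpos := Real.sqrt_pos.2 (sub_pos.2 hlt)
    have hR := Real.sq_sqrt (sub_pos.2 hlt).le
    refine ⟨hlt, ?_⟩
    set R := Real.sqrt ((en p + en q) ^ 2 - ((p + q) ⬝ᵥ ξ) ^ 2) with hRdef
    refine mass_shell_of_orthogonal hN (hsdef ▸ hs)
      (v := (hM p q / 2 * (en p + en q) / R) • ξ)
      (e := hM p q / 2 * ((p + q) ⬝ᵥ ξ) / R) ?_ ?_ ?_ rfl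
    · rw [← hsdef, ← hh, smul_dotProduct, dotProduct_smul, hξ]
      simp only [smul_eq_mul]
      field_simp
      rw [hR]
      ring
    · rw [dotProduct_smul, smul_eq_mul]
      ring
    · ext i
      simp only [pGS, ← hRdef, Pi.add_apply, Pi.smul_apply, smul_eq_mul]
      ring
  · have hM0 : (p + q) ⬝ᵥ (p + q) ≠ 0 := fun h => hn (dotProduct_self_eq_zero.1 h)
    have hspos : 0 < sM p q := by linarith
    have hrpos := Real.sqrt_pos.2 hspos
    have hr := Real.sq_sqrt hspos.le
    set r := Real.sqrt (sM p q) with hrdef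
    refine mass_shell_of_orthogonal hN (hsdef ▸ hs)
      (v := (hM p q / 2) • (ω + (((en p + en q) / r - 1) * ((p + q) ⬝ᵥ ω) /
        ((p + q) ⬝ᵥ (p + q))) • (p + q)))
      (e := hM p q / 2 * ((p + q) ⬝ᵥ ω) / r) ?_ ?_ ?_ rfl
    · rw [← hsdef, ← hh]
      have hr' : r ^ 2 = (en p + en q) ^ 2 - (p + q) ⬝ᵥ (p + q) := hr
      clear_value r
      generalize p + q = n at *
      generalize en p + en q = N at *
      simp only [smul_dotProduct, dotProduct_smul, add_dotProduct, dotProduct_add,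
        smul_eq_mul, hω, dotProduct_comm ω n]
      generalize n ⬝ᵥ n = M at *
      generalize n ⬝ᵥ ω = a at *
      have hN2 : N ^ 2 = r ^ 2 + M := by linarith
      field_simp
      linear_combination (4 * a ^ 2 * hM p q ^ 2) * hN2
    · generalize p + q = n at *
      simp only [dotProduct_smul, dotProduct_add, smul_eq_mul]
      field_simp
      ring
    · ext i
      simp only [pSt, ← hrdef, Pi.add_apply, Pi.smul_apply, smul_eq_mul]
      ring
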